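/- Let q be an acyclic Boolean conjunctive query, τ a join tree for q, and F, G, H pairwise distinct atoms of q. If F ↝ G and G ↝ H in the attack graph of τ, then F ↝ H or G ↝ F in the attack graph of τ. -/

import Mathlib

attribute [local instance] Classical.propDecidable

noncomputable section

/-- A term is either a variable (`Sum.inl v`) or a constant (`Sum.inr c`),
variables and constants both being coded by natural numbers
(the two copies of `ℕ` are disjoint). -/
abbrev Trm := ℕ ⊕ ℕ

/-- A database schema assigns to every relation name (a natural number) an
arity `n` and a primary-key length `k` with `n ≥ k ≥ 1`; the primary key
consists of the first `k` positions. -/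
structure Schema where
  arity : ℕ → ℕ
  keyLen : ℕ → ℕ
  keyLen_le_arity : ∀ R, keyLen R ≤ arity R
  one_le_keyLen : ∀ R, 1 ≤ keyLen R

/-- An atom: a relation name together with a list of arguments. -/
structure Atom where
  rel : ℕ
  args : List Trm
deriving DecidableEq

/-- Variables occurring in a list of terms. -/
def varsL (l : List Trm) : Finset ℕ := (l.filterMap Sum.getLeft?).toFinset

/-- Constants occurring in a list of terms. -/
def constsL (l : List Trm) : Finset ℕ := (l.filterMap Sum.getRight?).toFinset

/-- All variables of an atom. -/
def varsA (A : Atom) : Finset ℕ := varsL A.args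

/-- Key variables of an atom: variables in the primary-key positions. -/
def keyVars (S : Schema) (A : Atom) : Finset ℕ := varsL (A.args.take (S.keyLen A.rel))

/-- Constants of an atom. -/
def constsA (A : Atom) : Finset ℕ := constsL A.args

/-- Well-formed atom: number of arguments equals the arity of its relation name. -/
def wfAtom (S : Schema) (A : Atom) : Prop := A.args.length = S.arity A.rel

/-- A fact is an atom without variables. -/
def isFact (A : Atom) : Prop := ∀ t ∈ A.args, ∃ c : ℕ, t = Sum.inr c

/-- Two (facts) are key-equal: same relation name, and same primary-key positions. -/
def keyEqual (S : Schema) (A B : Atom) : Prop :=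
  A.rel = B.rel ∧ A.args.take (S.keyLen A.rel) = B.args.take (S.keyLen B.rel)

/-- The block of `A` in `db`: all facts of `db` key-equal to `A`. -/
def block (S : Schema) (A : Atom) (db : Finset Atom) : Finset Atom :=
  db.filter (fun B => keyEqual S A B)

/-- An uncertain database: a finite set of well-formed facts. -/
def IsDb (S : Schema) (db : Finset Atom) : Prop := ∀ A ∈ db, isFact A ∧ wfAtom S A

/-- A set of facts is consistent if it contains no two distinct key-equal facts. -/
def Consistent (S : Schema) (db : Finset Atom) : Prop :=
  ∀ A ∈ db, ∀ B ∈ db, keyEqual S A B → A = B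

/-- A repair of `db`: a maximal consistent subset of `db`. -/
def IsRepair (S : Schema) (db r : Finset Atom) : Prop :=
  r ⊆ db ∧ Consistent S r ∧
    ∀ r' : Finset Atom, r ⊆ r' → r' ⊆ db → Consistent S r' → r' = r

/-- Applying a valuation (a total map from variables to constants) to a term. -/
def appT (θ : ℕ → ℕ) : Trm → Trm
  | Sum.inl v => Sum.inr (θ v)
  | Sum.inr c => Sum.inr c

/-- Applying a valuation to an atom. -/
def appA (θ : ℕ → ℕ) (A : Atom) : Atom := ⟨A.rel, A.args.map (appT θ)⟩

/-- Applying a valuation to a query. -/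
def appQ (θ : ℕ → ℕ) (q : Finset Atom) : Finset Atom := q.image (appA θ)

/-- `db ⊨ q`: some valuation sends every atom of `q` into `db`. -/
def Sat (db q : Finset Atom) : Prop := ∃ θ : ℕ → ℕ, appQ θ q ⊆ db

/-- `db ∈ CERTAINTY(q)`: every repair of `db` satisfies `q`. -/
def Certainty (S : Schema) (q db : Finset Atom) : Prop :=
  ∀ r : Finset Atom, IsRepair S db r → Sat r q

/-- Variables of a query. -/
def varsQ (q : Finset Atom) : Finset ℕ := q.biUnion varsA

/-- Constants of a query. -/
def constsQ (q : Finset Atom) : Finset ℕ := q.biUnion constsA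

/-- `q` has no self-join: no two distinct atoms share a relation name. -/
def NoSelfJoin (q : Finset Atom) : Prop := ∀ F ∈ q, ∀ G ∈ q, F.rel = G.rel → F = G

/-- `db` is purified relative to `q`. -/
def Purified (q db : Finset Atom) : Prop :=
  ∀ A ∈ db, ∃ θ : ℕ → ℕ, A ∈ appQ θ q ∧ appQ θ q ⊆ db

/-- Active domain of a database: all constants occurring in its facts. -/
def adom (db : Finset Atom) : Finset ℕ := db.biUnion constsA

/-- Membership in the attribute closure of `X` under a set `FDs` of
functional dependencies (standard implication of functional dependencies). -/
inductive InCl (FDs : Set (Finset ℕ × Finset ℕ)) (X : Finset ℕ) : ℕ → Prop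
  | base {x : ℕ} : x ∈ X → InCl FDs X x
  | step {Z W : Finset ℕ} {w : ℕ} : (Z, W) ∈ FDs → (∀ z ∈ Z, InCl FDs X z) →
      w ∈ W → InCl FDs X w

/-- `FDs ⊨ X → Y`. -/
def FDImp (FDs : Set (Finset ℕ × Finset ℕ)) (X Y : Finset ℕ) : Prop :=
  ∀ y ∈ Y, InCl FDs X y

/-- `FD(q) = { key(F) → vars(F) : F ∈ q }`. -/
def FDq (S : Schema) (q : Finset Atom) : Set (Finset ℕ × Finset ℕ) :=
  {p | ∃ F ∈ q, p = (keyVars S F, varsA F)}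

/-- `F^{+,q} = {x ∈ vars(q) : FD(q \ {F}) ⊨ key(F) → x}`. -/
def plusCl (S : Schema) (q : Finset Atom) (F : Atom) : Set ℕ :=
  {x | x ∈ varsQ q ∧ InCl (FDq S (q.erase F)) (keyVars S F) x}

/-- `F^{⊕,q} = {x ∈ vars(q) : FD(q) ⊨ key(F) → x}`. -/
def oplusCl (S : Schema) (q : Finset Atom) (F : Atom) : Set ℕ :=
  {x | x ∈ varsQ q ∧ InCl (FDq S q) (keyVars S F) x}

/-- A (simple) path in an undirected graph given by edge relation `E`. -/
def IsPath (E : Atom → Atom → Prop) (p : List Atom) : Prop :=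
  p ≠ [] ∧ p.Nodup ∧ List.Chain' E p

/-- `E` is (the edge relation of) a join tree for `q`: a tree (unique simple
paths between any two vertices) on the atoms of `q` satisfying the
Connectedness Condition. -/
def IsJoinTree (q : Finset Atom) (E : Atom → Atom → Prop) : Prop :=
  (∀ a b, E a b → E b a) ∧
  (∀ a b, E a b → a ∈ q ∧ b ∈ q ∧ a ≠ b) ∧
  (∀ a ∈ q, ∀ b ∈ q, ∃! p : List Atom,
      IsPath E p ∧ p.head? = some a ∧ p.getLast? = some b) ∧
  (∀ x : ℕ, ∀ F ∈ q, ∀ G ∈ q, x ∈ varsA F → x ∈ varsA G →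
      ∀ p : List Atom, IsPath E p → p.head? = some F → p.getLast? = some G →
        ∀ H ∈ p, x ∈ varsA H)

/-- The consecutive pairs (edges) of a path. -/
def edgePairs (p : List Atom) : List (Atom × Atom) := p.zip p.tail

/-- `F ↝ G` in the attack graph of the join tree `E` of `q`: `F ≠ G` are atoms
of `q`, and no label `vars(H) ∩ vars(H')` of an edge on the (unique) path from
`F` to `G` is contained in `F^{+,q}`. -/
def Attacks (S : Schema) (q : Finset Atom) (E : Atom → Atom → Prop) (F G : Atom) : Prop :=
  F ∈ q ∧ G ∈ q ∧ F ≠ G ∧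
  ∀ p : List Atom, IsPath E p → p.head? = some F → p.getLast? = some G →
    ∀ e ∈ edgePairs p, ¬ ((↑(varsA e.1 ∩ varsA e.2) : Set ℕ) ⊆ plusCl S q F)

/-- The attack `F ↝ G` is weak: `key(G) ⊆ F^{⊕,q}`. -/
def Weak (S : Schema) (q : Finset Atom) (F G : Atom) : Prop :=
  (↑(keyVars S G) : Set ℕ) ⊆ oplusCl S q F

/-- Consecutive pairs of a cyclic sequence, including the wrap-around pair. -/
def cyclePairs (L : List Atom) : List (Atom × Atom) := L.zip (L.rotate 1)

/-- `L` is an (elementary directed) cycle in the directed graph `att`. -/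
def IsCycle (att : Atom → Atom → Prop) (L : List Atom) : Prop :=
  2 ≤ L.length ∧ L.Nodup ∧ ∀ e ∈ cyclePairs L, att e.1 e.2

/-- A cycle is terminal: no edge leads from a vertex in the cycle to a vertex
outside the cycle. -/
def TerminalCycle (att : Atom → Atom → Prop) (L : List Atom) : Prop :=
  ∀ a ∈ L, ∀ b, att a b → b ∈ L

/-- A strong cycle in the attack graph: a cycle at least one attack of which is strong. -/
def StrongCycle (S : Schema) (q : Finset Atom) (E : Atom → Atom → Prop)
    (L : List Atom) : Prop :=
  IsCycle (Attacks S q E) L ∧ ∃ e ∈ cyclePairs L, ¬ Weak S q e.1 e.2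

/-- Substituting constant `c` for variable `z` in a term. -/
def substT (z c : ℕ) : Trm → Trm
  | Sum.inl v => if v = z then Sum.inr c else Sum.inl v
  | Sum.inr d => Sum.inr d

/-- `F[z→c]`. -/
def substA (z c : ℕ) (A : Atom) : Atom := ⟨A.rel, A.args.map (substT z c)⟩

/-- `q[z→c]`. -/
def substQ (z c : ℕ) (q : Finset Atom) : Finset Atom := q.image (substA z c)

/-- Simultaneous substitution of the constants `bs` for the (distinct)
variables `xs` (componentwise) in a term. -/
def substLT (xs bs : List ℕ) : Trm → Trm
  | Sum.inl v => if v ∈ xs then Sum.inr (bs.getD (xs.idxOf v) 0) else Sum.inl v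
  | Sum.inr d => Sum.inr d

/-- `F[x⃗→b⃗]`. -/
def substLA (xs bs : List ℕ) (A : Atom) : Atom := ⟨A.rel, A.args.map (substLT xs bs)⟩

/-- `q[x⃗→b⃗]`. -/
def substLQ (xs bs : List ℕ) (q : Finset Atom) : Finset Atom := q.image (substLA xs bs)

/-- First-order formulas over the relational vocabulary (relation names and
constants coded by naturals, variables coded by naturals). -/
inductive Fml where
  | atom (R : ℕ) (args : List Trm)
  | eq (s t : Trm)
  | tru
  | not (φ : Fml)
  | and (φ ψ : Fml)
  | or (φ ψ : Fml)
  | ex (v : ℕ) (φ : Fml)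
  | all (v : ℕ) (φ : Fml)

/-- Value of a term under an assignment of constants to variables. -/
def evalT (σ : ℕ → ℕ) : Trm → ℕ
  | Sum.inl v => σ v
  | Sum.inr c => c

/-- Satisfaction of a first-order formula in the finite structure whose
relations are given by the facts of `db`, with quantifiers ranging over `dom`. -/
def Holds (db : Finset Atom) (dom : Finset ℕ) : Fml → (ℕ → ℕ) → Prop
  | .atom R args, σ => (⟨R, args.map fun t => Sum.inr (evalT σ t)⟩ : Atom) ∈ db
  | .eq s t, σ => evalT σ s = evalT σ t
  | .tru, _ => True
  | .not φ, σ => ¬ Holds db dom φ σ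
  | .and φ ψ, σ => Holds db dom φ σ ∧ Holds db dom ψ σ
  | .or φ ψ, σ => Holds db dom φ σ ∨ Holds db dom ψ σ
  | .ex v φ, σ => ∃ a ∈ dom, Holds db dom φ (Function.update σ v a)
  | .all v φ, σ => ∀ a ∈ dom, Holds db dom φ (Function.update σ v a)

/-- Free variables of a formula. -/
def Fml.free : Fml → Finset ℕ
  | .atom _ args => varsL args
  | .eq s t => varsL [s, t]
  | .tru => ∅
  | .not φ => φ.free
  | .and φ ψ => φ.free ∪ ψ.free
  | .or φ ψ => φ.free ∪ ψ.free
  | .ex v φ => φ.free.erase v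
  | .all v φ => φ.free.erase v

/-- Relation names occurring in a formula. -/
def Fml.rels : Fml → Finset ℕ
  | .atom R _ => {R}
  | .eq _ _ => ∅
  | .tru => ∅
  | .not φ => φ.rels
  | .and φ ψ => φ.rels ∪ ψ.rels
  | .or φ ψ => φ.rels ∪ ψ.rels
  | .ex _ φ => φ.rels
  | .all _ φ => φ.rels

/-- Constants occurring in a formula. -/
def Fml.consts : Fml → Finset ℕ
  | .atom _ args => constsL args
  | .eq s t => constsL [s, t]
  | .tru => ∅
  | .not φ => φ.consts
  | .and φ ψ => φ.consts ∪ ψ.consts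
  | .or φ ψ => φ.consts ∪ ψ.consts
  | .ex _ φ => φ.consts
  | .all _ φ => φ.consts

/-- Well-formed formula: every atom has as many arguments as the arity of its
relation name. -/
def FmlWf (S : Schema) : Fml → Prop
  | .atom R args => args.length = S.arity R
  | .eq _ _ => True
  | .tru => True
  | .not φ => FmlWf S φ
  | .and φ ψ => FmlWf S φ ∧ FmlWf S ψ
  | .or φ ψ => FmlWf S φ ∧ FmlWf S ψ
  | .ex _ φ => FmlWf S φ
  | .all _ φ => FmlWf S φ

/-- The safety predicate of Dalvi, Ré and Suciu (rules SE1–SE4). -/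
inductive Safe (S : Schema) : Finset Atom → Prop
  | se1 (A : Atom) : isFact A → Safe S {A}
  | se2 (q₁ q₂ : Finset Atom) : q₁.Nonempty → q₂.Nonempty →
      Disjoint (varsQ q₁) (varsQ q₂) → Safe S q₁ → Safe S q₂ → Safe S (q₁ ∪ q₂)
  | se3 (q : Finset Atom) (x a : ℕ) : (∀ F ∈ q, x ∈ keyVars S F) →
      Safe S (substQ x a q) → Safe S q
  | se4 (q : Finset Atom) (F : Atom) (x a : ℕ) : F ∈ q → keyVars S F = ∅ →
      varsA F ≠ ∅ → x ∈ varsA F → Safe S (substQ x a q) → Safe S q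

/-- The atom `R_i(x_i ; x_{i+1})` (with `x_{k+1} = x_1`) of the query `acq_k`;
variable `x_i` is coded by `i`, relation name `R_i` by `i`. -/
def Ratom (k i : ℕ) : Atom := ⟨i, [Sum.inl i, Sum.inl (i % k + 1)]⟩

/-- The all-key atom `S_k(x_1,…,x_k)` of the query `acq_k`;
relation name `S_k` is coded by `0`. -/
def Satom (k : ℕ) : Atom := ⟨0, (List.range k).map (fun j => Sum.inl (j + 1))⟩

/-- The query `acq_k = {R_1(x_1;x_2), …, R_k(x_k;x_1), S_k(x_1,…,x_k)}`. -/
def acq (k : ℕ) : Finset Atom := ((Finset.Icc 1 k).image (Ratom k)) ∪ {Satom k}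

/-- Sum of `Pr` over the possible (= consistent) worlds of `db` satisfying `P`. -/
def prOf (S : Schema) (db : Finset Atom) (Pr : Finset Atom → ℚ)
    (P : Finset Atom → Prop) : ℚ :=
  ∑ w ∈ db.powerset.filter (fun w => Consistent S w ∧ P w), Pr w

end

def CutR (E : Atom → Atom → Prop) (u v a b : Atom) : Prop :=
  E a b ∧ ¬ (a = u ∧ b = v) ∧ ¬ (a = v ∧ b = u)

/-- connected after deleting the edge `u v`. -/
def Cn (E : Atom → Atom → Prop) (u v : Atom) : Atom → Atom → Prop :=
  Relation.ReflTransGen (CutR E u v)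

theorem Cn.symm' {E : Atom → Atom → Prop} (hs : ∀ a b, E a b → E b a) {u v a b : Atom}
    (h : Cn E u v a b) : Cn E u v b a := by
  induction h with
  | refl => exact .refl
  | tail _ hb ih =>
    refine Relation.ReflTransGen.head ⟨hs _ _ hb.1, ?_, ?_⟩ ih
    · rintro ⟨h1, h2⟩; exact hb.2.2 ⟨h2, h1⟩
    · rintro ⟨h1, h2⟩; exact hb.2.1 ⟨h2, h1⟩

theorem chain_reach {R : Atom → Atom → Prop} : ∀ (p : List Atom) (a : Atom),
    List.IsChain R p → p.head? = some a → ∀ K ∈ p, Relation.ReflTransGen R a K := by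
  intro p
  induction p with
  | nil => simp
  | cons x l ih =>
    intro a hc ha K hK
    simp at ha; subst ha
    rcases List.mem_cons.1 hK with rfl | hK
    · exact .refl
    · cases l with
      | nil => simp at hK
      | cons y l =>
        rw [List.isChain_cons_cons] at hc
        exact .head hc.1 (ih y hc.2 rfl K hK)

theorem reach_path {R : Atom → Atom → Prop} {a b : Atom} (h : Relation.ReflTransGen R a b) :
    ∃ p : List Atom, IsPath R p ∧ p.head? = some a ∧ p.getLast? = some b := by
  induction h using Relation.ReflTransGen.head_induction_on with
  | refl => exact ⟨[b], ⟨by simp, by simp, List.isChain_singleton _⟩, rfl, rfl⟩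
  | @head a c hac _ ih =>
    obtain ⟨p, ⟨hne, hnd, hch⟩, hh, hl⟩ := ih
    by_cases ha : a ∈ p
    · obtain ⟨s, t, rfl⟩ := List.append_of_mem ha
      refine ⟨a :: t, ⟨by simp, (List.nodup_append.1 hnd).2.1, ?_⟩, rfl, ?_⟩
      · exact hch.right_of_append
      · rw [List.getLast?_append] at hl
        cases h : (a :: t).getLast? with
        | none => simp at h
        | some z => rw [h] at hl; simpa using hl
    · refine ⟨a :: p, ⟨by simp, List.nodup_cons.2 ⟨ha, hnd⟩, ?_⟩, rfl, ?_⟩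
      · cases p with
        | nil => exact absurd rfl hne
        | cons y l =>
          simp at hh; subst hh
          exact List.isChain_cons_cons.2 ⟨hac, hch⟩
      · cases p with
        | nil => exact absurd rfl hne
        | cons y l => simpa using hl

theorem chain_edges {R : Atom → Atom → Prop} : ∀ (p : List Atom),
    List.IsChain R p ↔ ∀ e ∈ edgePairs p, R e.1 e.2 := by
  intro p
  induction p with
  | nil => simp [edgePairs]
  | cons x l ih =>
    cases l with
    | nil => simp [edgePairs]
    | cons y l =>
      rw [List.isChain_cons_cons, ih]
      simp [edgePairs]

theorem edge_mem {p : List Atom} {e : Atom × Atom} (h : e ∈ edgePairs p) :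
    e.1 ∈ p ∧ e.2 ∈ p := by
  have := List.of_mem_zip (a := e.1) (b := e.2) h
  exact ⟨this.1, List.mem_of_mem_tail this.2⟩

theorem last_edge : ∀ (p : List Atom) (a b : Atom), a ≠ b → p.head? = some a →
    p.getLast? = some b → ∃ e ∈ edgePairs p, e.2 = b := by
  intro p
  induction p with
  | nil => simp
  | cons x l ih =>
    intro a b hab ha hb
    cases l with
    | nil => simp at ha hb; exact absurd (ha.symm.trans hb) hab
    | cons y l =>
      by_cases hy : y = b
      · exact ⟨(x, y), by simp [edgePairs], hy⟩
      · obtain ⟨e, he, h⟩ := ih y b hy rfl (by simpa using hb)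
        refine ⟨e, ?_, h⟩
        have : edgePairs (x :: y :: l) = (x, y) :: edgePairs (y :: l) := by simp [edgePairs]
        rw [this]; exact List.mem_cons_of_mem _ he

theorem edge_cut {q : Finset Atom} {E : Atom → Atom → Prop} (hjt : IsJoinTree q E)
    {a b : Atom} (ha : a ∈ q) (hb : b ∈ q) {p : List Atom} (hp : IsPath E p)
    (hh : p.head? = some a) (hl : p.getLast? = some b) {e : Atom × Atom}
    (he : e ∈ edgePairs p) : ¬ Cn E e.1 e.2 a b := by
  intro h
  obtain ⟨p', ⟨h1, h2, h3⟩, h4, h5⟩ := reach_path h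
  have hch := (chain_edges p').1 h3
  have hp' : IsPath E p' := ⟨h1, h2, (chain_edges p').2 fun e he => (hch e he).1⟩
  obtain rfl := (hjt.2.2.1 a ha b hb).unique ⟨hp, hh, hl⟩ ⟨hp', h4, h5⟩
  exact (hch e he).2.1 ⟨rfl, rfl⟩

theorem cut_edge {E : Atom → Atom → Prop} {a b u v : Atom} {p : List Atom} (hp : IsPath E p)
    (hh : p.head? = some a) (hl : p.getLast? = some b) (h : ¬ Cn E u v a b) :
    (u, v) ∈ edgePairs p ∨ (v, u) ∈ edgePairs p := by
  by_contra hcon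
  push Not at hcon
  apply h
  refine chain_reach p a ((chain_edges p).2 fun e he => ⟨(chain_edges p).1 hp.2.2 e he, ?_, ?_⟩)
    hh b (List.mem_of_getLast? hl)
  · rintro ⟨rfl, rfl⟩; exact hcon.1 he
  · rintro ⟨rfl, rfl⟩; exact hcon.2 he

theorem attacks_cut {S : Schema} {q : Finset Atom} {E : Atom → Atom → Prop}
    (hjt : IsJoinTree q E) {F G : Atom} (h : Attacks S q E F G) {u v : Atom}
    (hc : ¬ Cn E u v F G) : ¬ ((↑(varsA u ∩ varsA v) : Set ℕ) ⊆ plusCl S q F) := by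
  obtain ⟨hF, hG, -, h⟩ := h
  obtain ⟨p, ⟨hp, hh, hl⟩, -⟩ := hjt.2.2.1 F hF G hG
  rcases cut_edge hp hh hl hc with he | he
  · exact h p hp hh hl _ he
  · intro hsub
    refine h p hp hh hl _ he fun x hx => hsub ?_
    have hx := Finset.mem_inter.1 (Finset.mem_coe.1 hx)
    exact Finset.mem_coe.2 (Finset.mem_inter.2 ⟨hx.2, hx.1⟩)

theorem not_attacks {S : Schema} {q : Finset Atom} {E : Atom → Atom → Prop}
    (hjt : IsJoinTree q E) {F G : Atom} (hF : F ∈ q) (hG : G ∈ q) (hne : F ≠ G)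
    (h : ¬ Attacks S q E F G) : ∃ u v : Atom, ¬ Cn E u v F G ∧
      ((↑(varsA u ∩ varsA v) : Set ℕ) ⊆ plusCl S q F) := by
  by_contra hcon
  push Not at hcon
  exact h ⟨hF, hG, hne, fun p hp hh hl e he => hcon _ _ (edge_cut hjt hF hG hp hh hl he)⟩

/-- If `F ↝ G` and `G ↝ H` in the attack graph of a join tree for
`q`, where `F, G, H` are pairwise distinct atoms of `q`, then `F ↝ H` or `G ↝ F`. -/
theorem statement3 (S : Schema) (q : Finset Atom) (hq : ∀ F ∈ q, wfAtom S F)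
    (E : Atom → Atom → Prop) (hjt : IsJoinTree q E)
    (F G H : Atom) (hF : F ∈ q) (hG : G ∈ q) (hH : H ∈ q)
    (hFG : F ≠ G) (hGH : G ≠ H) (hFH : F ≠ H)
    (h1 : Attacks S q E F G) (h2 : Attacks S q E G H) :
    Attacks S q E F H ∨ Attacks S q E G F := by
  by_contra hcon
  push Not at hcon
  obtain ⟨hn1, hn2⟩ := hcon
  obtain ⟨u, v, huv, hL⟩ := not_attacks hjt hF hH hFH hn1
  obtain ⟨s, t, hst, hLst⟩ := not_attacks hjt hG hF hFG.symm hn2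
  have hs := hjt.1
  -- the edge `u v` separates `G` from `H`
  have huvFG : Cn E u v F G := by
    by_contra hc; exact attacks_cut hjt h1 hc hL
  have huvGH : ¬ Cn E u v G H := fun hc => huv (huvFG.trans hc)
  have hstGH : Cn E s t G H := by
    by_contra hc; exact attacks_cut hjt h2 hc hLst
  -- `key(G)` is not contained in `F⁺`
  have hkey : ¬ ∀ z ∈ keyVars S G, InCl (FDq S (q.erase F)) (keyVars S F) z := by
    intro hk
    obtain ⟨p, ⟨hp, hh, hl⟩, -⟩ := hjt.2.2.1 F hF G hG
    obtain ⟨e, he, heG⟩ := last_edge p F G hFG hh hl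
    refine h1.2.2.2 p hp hh hl e he ?_
    intro x hx
    have hx : x ∈ varsA G := by
      rw [← heG]; exact (Finset.mem_inter.1 (Finset.mem_coe.1 hx)).2
    exact ⟨Finset.mem_biUnion.2 ⟨G, hG, hx⟩,
      InCl.step ⟨G, Finset.mem_erase.2 ⟨hFG.symm, hG⟩, rfl⟩ hk hx⟩
  -- a variable shared across the cut lies in the label of `s t`
  have hcross : ∀ K ∈ q, ∀ K' ∈ q, Cn E s t F K → ¬ Cn E s t F K' → ∀ x ∈ varsA K,
      x ∈ varsA K' → x ∈ plusCl S q G := by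
    intro K hK K' hK' hc hc' x hx hx'
    obtain ⟨p, ⟨hp, hh, hl⟩, -⟩ := hjt.2.2.1 K hK K' hK'
    have hv := hjt.2.2.2 x K hK K' hK' hx hx' p hp hh hl
    have hmem : s ∈ p ∧ t ∈ p := by
      rcases cut_edge (u := s) (v := t) hp hh hl (fun h => hc' (hc.trans h)) with he | he
      · exact edge_mem he
      · exact (edge_mem he).symm
    exact hLst (Finset.mem_coe.2 (Finset.mem_inter.2 ⟨hv s hmem.1, hv t hmem.2⟩))
  have hkv : ∀ A : Atom, keyVars S A ⊆ varsA A := by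
    intro A x hx
    simp only [keyVars, varsA, varsL, List.mem_toFinset, List.mem_filterMap] at hx ⊢
    obtain ⟨a, ha, hx⟩ := hx
    exact ⟨a, List.mem_of_mem_take ha, hx⟩
  -- main induction
  have hmain : ∀ x, InCl (FDq S (q.erase F)) (keyVars S F) x →
      ∀ K' ∈ q, ¬ Cn E s t F K' → x ∈ varsA K' → x ∈ plusCl S q G := by
    intro x hx
    induction hx with
    | base hx =>
      intro K' hK' hc' hx'
      exact hcross F hF K' hK' .refl hc' _ (hkv F hx) hx'
    | @step Z W w hZW hZ hw ih =>
      intro K' hK' hc' hx'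
      obtain ⟨K, hK, hKe⟩ := hZW
      obtain ⟨rfl, rfl⟩ := Prod.mk.inj hKe
      have hKq := (Finset.mem_erase.1 hK).2
      by_cases hc : Cn E s t F K
      · exact hcross K hKq K' hK' hc hc' _ hw hx'
      · have hKG : K ≠ G := by
          rintro rfl; exact hkey hZ
        exact ⟨Finset.mem_biUnion.2 ⟨K, hKq, hw⟩,
          InCl.step ⟨K, Finset.mem_erase.2 ⟨hKG, hKq⟩, rfl⟩
            (fun z hz => (ih z hz K hKq hc (hkv K hz)).2) hw⟩
  -- `u` lies on the `G`-side of `s t`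
  obtain ⟨p, ⟨hp, hh, hl⟩, -⟩ := hjt.2.2.1 G hG H hH
  have hup : u ∈ p ∧ ∃ w, E u w := by
    rcases cut_edge hp hh hl huvGH with he | he
    · exact ⟨(edge_mem he).1, _, (chain_edges p).1 hp.2.2 _ he⟩
    · exact ⟨(edge_mem he).2, _, hs _ _ ((chain_edges p).1 hp.2.2 _ he)⟩
  obtain ⟨hup, w, huw⟩ := hup
  have huq : u ∈ q := (hjt.2.1 _ _ huw).1
  have hGu : Cn E s t G u := by
    refine chain_reach p G ((chain_edges p).2 fun e he =>
      ⟨(chain_edges p).1 hp.2.2 e he, ?_, ?_⟩) hh u hup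
    · rintro ⟨rfl, rfl⟩; exact edge_cut hjt hG hH hp hh hl he hstGH
    · rintro ⟨rfl, rfl⟩
      refine attacks_cut hjt h2 (edge_cut hjt hG hH hp hh hl he) ?_
      rw [Finset.inter_comm]; exact hLst
  have hFu : ¬ Cn E s t F u := fun h => hst (hGu.trans (Cn.symm' hs h))
  refine attacks_cut hjt h2 huvGH fun x hx => ?_
  exact hmain x (hL hx).2 u huq hFu (Finset.mem_inter.1 (Finset.mem_coe.1 hx)).1
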